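/- For every D with 1 ≤ D ≤ |B|, MR(D) = min{|N(Y)| : Y ⊆ B, |Y| = D}; that is, the minimum number of removals from A causing at least D failures in B equals the minimum size of the neighborhood of a D-element subset of B. -/

import Mathlib

/-- In a bidirectional interdependent network with star topologies
(finite bipartite graph, parts `A` and `B`, neighborhoods `N : B → Finset A`,
removing `X ⊆ A` fails exactly the vertices `v ∈ B` with `N(v) ⊆ X`), for every
`D` with `1 ≤ D ≤ |B|`,
`MR(D) = min{|X| : X ⊆ A, |{v ∈ B : N(v) ⊆ X}| ≥ D}`
equals `min{|N(Y)| : Y ⊆ B, |Y| = D}`. -/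
theorem MR_eq_min_neighborhood
    {A B : Type*} [Fintype A] [Fintype B] [DecidableEq A] [DecidableEq B]
    (N : B → Finset A) (D : ℕ) (hD1 : 1 ≤ D) (hD2 : D ≤ Fintype.card B) :
    sInf {n : ℕ | ∃ X : Finset A, X.card = n ∧
        D ≤ (Finset.univ.filter (fun v : B => N v ⊆ X)).card} =
    sInf {n : ℕ | ∃ Y : Finset B, Y.card = D ∧ (Y.biUnion N).card = n} := by
  apply le_antisymm
  · obtain ⟨Y₀, -, hY₀⟩ := Finset.exists_subset_card_eq (s := (Finset.univ : Finset B)) hD2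
    refine le_csInf ⟨_, Y₀, hY₀, rfl⟩ ?_
    rintro _ ⟨Y, hY, rfl⟩
    refine Nat.sInf_le ⟨Y.biUnion N, rfl, hY.ge.trans (Finset.card_le_card fun v hv => ?_)⟩
    simpa using Finset.subset_biUnion_of_mem N hv
  · refine le_csInf ⟨_, Finset.univ, rfl, by simpa using hD2⟩ ?_
    rintro _ ⟨X, rfl, hX⟩
    obtain ⟨Y, hYX, hY⟩ := Finset.exists_subset_card_eq hX
    have hN : Y.biUnion N ⊆ X :=
      Finset.biUnion_subset.2 fun v hv => (Finset.mem_filter.1 (hYX hv)).2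
    exact le_trans (Nat.sInf_le ⟨Y, hY, rfl⟩) (Finset.card_le_card hN)
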